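/- Under the two-group random mixture model, for each α∈[0,1] one has mFNR*(α) = b*(α); moreover the Neyman–Pearson rule δ^n_NP(α) is an optimal solution of the mFDR-constrained problem, i.e. mFDR(δ^n_NP(α)) ≤ α and mFNR(δ^n_NP(α)) = mFNR*(α). -/

import Mathlib

open MeasureTheory ProbabilityTheory Filter

namespace TwoGroup

/-- The two-group random mixture model: a σ-finite base measure on the sample space `𝒳`,
a null proportion `π0 ∈ (0,1)`, and null/non-null probability density functions `f0`, `f1`
with respect to the base measure. -/
structure Model (𝒳 : Type*) [MeasurableSpace 𝒳] where
  base : Measure 𝒳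
  sigmaFinite : SigmaFinite base
  π0 : ℝ
  π0_mem : π0 ∈ Set.Ioo (0 : ℝ) 1
  f0 : 𝒳 → ℝ
  f1 : 𝒳 → ℝ
  f0_meas : Measurable f0
  f1_meas : Measurable f1
  f0_nonneg : ∀ x, 0 ≤ f0 x
  f1_nonneg : ∀ x, 0 ≤ f1 x
  f0_prob : IsProbabilityMeasure (base.withDensity fun x => ENNReal.ofReal (f0 x))
  f1_prob : IsProbabilityMeasure (base.withDensity fun x => ENNReal.ofReal (f1 x))

namespace Model

variable {𝒳 : Type*} [MeasurableSpace 𝒳] (M : Model 𝒳)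

/-- The non-null proportion `π1 = 1 - π0`. -/
noncomputable def π1 : ℝ := 1 - M.π0

/-- The marginal density `f = π0 f0 + π1 f1`. -/
noncomputable def f (x : 𝒳) : ℝ := M.π0 * M.f0 x + M.π1 * M.f1 x

/-- The local false discovery rate `Lfdr(x) = π0 f0(x) / f(x)`. -/
noncomputable def Lfdr (x : 𝒳) : ℝ := M.π0 * M.f0 x / M.f x

/-- The joint law of a single pair `(θ, X)`; `true` encodes `θ = 1` (non-null). -/
noncomputable def joint : Measure (Bool × 𝒳) :=
  (ENNReal.ofReal M.π0) •
      ((Measure.dirac false).prod (M.base.withDensity fun x => ENNReal.ofReal (M.f0 x))) +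
    (ENNReal.ofReal M.π1) •
      ((Measure.dirac true).prod (M.base.withDensity fun x => ENNReal.ofReal (M.f1 x)))

/-- The joint law of `((θ1, X1), …, (θn, Xn))`: i.i.d. copies of `(θ, X)`. -/
noncomputable def jointN (n : ℕ) : Measure (Fin n → Bool × 𝒳) :=
  Measure.pi fun _ => M.joint

end Model

/-- Number of rejections `Σ_i δ_i`. -/
def nRej {n : ℕ} (d : Fin n → Bool) : ℝ := ∑ i, if d i then (1 : ℝ) else 0

/-- Number of false discoveries `Σ_i δ_i (1 - θ_i)`. -/
def nFD {n : ℕ} (θ d : Fin n → Bool) : ℝ :=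
  ∑ i, (if d i then (1 : ℝ) else 0) * (if θ i then (0 : ℝ) else 1)

/-- Number of acceptances `Σ_i (1 - δ_i)`. -/
def nAcc {n : ℕ} (d : Fin n → Bool) : ℝ := ∑ i, if d i then (0 : ℝ) else 1

/-- Number of false non-discoveries `Σ_i (1 - δ_i) θ_i`. -/
def nFN {n : ℕ} (θ d : Fin n → Bool) : ℝ :=
  ∑ i, (if d i then (0 : ℝ) else 1) * (if θ i then (1 : ℝ) else 0)

/-- False discovery proportion. -/
noncomputable def FDP {n : ℕ} (θ d : Fin n → Bool) : ℝ := nFD θ d / max 1 (nRej d)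

/-- False non-discovery proportion. -/
noncomputable def FNP {n : ℕ} (θ d : Fin n → Bool) : ℝ := nFN θ d / max 1 (nAcc d)

/-- A decision rule is a Markov kernel from `𝒳^n` to `{0,1}^n`: a measurable family of
probability measures on `Fin n → Bool`. -/
def IsRule {𝒳 : Type*} [MeasurableSpace 𝒳] {n : ℕ}
    (κ : (Fin n → 𝒳) → Measure (Fin n → Bool)) : Prop :=
  Measurable κ ∧ ∀ x, IsProbabilityMeasure (κ x)

namespace Model

variable {𝒳 : Type*} [MeasurableSpace 𝒳] (M : Model 𝒳)

/-- The false discovery rate `FDR = E[FDP]` of a (randomized) decision rule. -/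
noncomputable def FDR (n : ℕ) (κ : (Fin n → 𝒳) → Measure (Fin n → Bool)) : ℝ :=
  ∫ ω, ∫ d, FDP (fun i => (ω i).1) d ∂(κ fun i => (ω i).2) ∂(M.jointN n)

/-- The false non-discovery rate `FNR = E[FNP]` of a (randomized) decision rule. -/
noncomputable def FNR (n : ℕ) (κ : (Fin n → 𝒳) → Measure (Fin n → Bool)) : ℝ :=
  ∫ ω, ∫ d, FNP (fun i => (ω i).1) d ∂(κ fun i => (ω i).2) ∂(M.jointN n)

/-- The marginal FDR `mFDR = E[Σ δi (1-θi)] / E[Σ δi]` (with `0/0 = 0`). -/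
noncomputable def mFDR (n : ℕ) (κ : (Fin n → 𝒳) → Measure (Fin n → Bool)) : ℝ :=
  (∫ ω, ∫ d, nFD (fun i => (ω i).1) d ∂(κ fun i => (ω i).2) ∂(M.jointN n)) /
    (∫ ω, ∫ d, nRej d ∂(κ fun i => (ω i).2) ∂(M.jointN n))

/-- The marginal FNR `mFNR = E[Σ (1-δi) θi] / E[Σ (1-δi)]` (with `0/0 = 0`). -/
noncomputable def mFNR (n : ℕ) (κ : (Fin n → 𝒳) → Measure (Fin n → Bool)) : ℝ :=
  (∫ ω, ∫ d, nFN (fun i => (ω i).1) d ∂(κ fun i => (ω i).2) ∂(M.jointN n)) /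
    (∫ ω, ∫ d, nAcc d ∂(κ fun i => (ω i).2) ∂(M.jointN n))

/-- `FNR*_n(α)`: the minimum FNR over decision rules controlling FDR at level `α`. -/
noncomputable def FNRstar (n : ℕ) (α : ℝ) : ℝ :=
  sInf {r | ∃ κ : (Fin n → 𝒳) → Measure (Fin n → Bool),
    IsRule κ ∧ M.FDR n κ ≤ α ∧ r = M.FNR n κ}

/-- The minimum mFNR over decision rules for `n` hypotheses controlling mFDR at level `α`. -/
noncomputable def mFNRstarN (n : ℕ) (α : ℝ) : ℝ :=
  sInf {r | ∃ κ : (Fin n → 𝒳) → Measure (Fin n → Bool),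
    IsRule κ ∧ M.mFDR n κ ≤ α ∧ r = M.mFNR n κ}

/-- `mFNR*(α)` (this quantity does not depend on the number of hypotheses; we take `n = 1`). -/
noncomputable def mFNRstar (α : ℝ) : ℝ := M.mFNRstarN 1 α

/-- The marginal law of a single observation `X ∼ f`. -/
noncomputable def Pmix : Measure 𝒳 := M.base.withDensity fun x => ENNReal.ofReal (M.f x)

/-- The law of `W = Lfdr(X)`, `X ∼ f`. -/
noncomputable def νW : Measure ℝ := M.Pmix.map M.Lfdr

/-- `G(t) = P(W ≤ t)`. -/
noncomputable def G (t : ℝ) : ℝ := (M.νW (Set.Iic t)).toReal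

/-- `Ḡ(t) = P(W < t)`. -/
noncomputable def Gbar (t : ℝ) : ℝ := (M.νW (Set.Iio t)).toReal

/-- The generalized inverse `G^{-1}(u) = inf{t : G(t) ≥ u}`. -/
noncomputable def Ginv (u : ℝ) : ℝ := sInf {t | u ≤ M.G t}

/-- `P(W = t)`. -/
noncomputable def atom (t : ℝ) : ℝ := (M.νW {t}).toReal

/-- The randomization probability `p(u)`, satisfying
`Ḡ(G^{-1}(u)) + p(u) P(W = G^{-1}(u)) = u`. -/
noncomputable def pu (u : ℝ) : ℝ := (u - M.Gbar (M.Ginv u)) / M.atom (M.Ginv u)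

/-- `a(u) = E[W | S_u = 1]` for `u ∈ (0,1]`, `a(0) = 0`, where `S_u` is the Bernoulli(u)
thresholding variable of `W` at `G^{-1}(u)` with randomization `p(u)` at the boundary. -/
noncomputable def a (u : ℝ) : ℝ :=
  if u = 0 then 0
  else ((∫ w in Set.Iio (M.Ginv u), w ∂M.νW) + M.pu u * (M.Ginv u * M.atom (M.Ginv u))) / u

/-- `b(u) = E[1 - W | S_u = 0]` for `u ∈ [0,1)`, `b(1) = 0`. -/
noncomputable def b (u : ℝ) : ℝ :=
  if u = 1 then 0
  else ((∫ w in Set.Ioi (M.Ginv u), (1 - w) ∂M.νW)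
      + (1 - M.pu u) * ((1 - M.Ginv u) * M.atom (M.Ginv u))) / (1 - u)

/-- `b*(α) = inf{b(u) : u ∈ [0,1], a(u) ≤ α}`. -/
noncomputable def bstar (α : ℝ) : ℝ :=
  sInf {y | ∃ u ∈ Set.Icc (0 : ℝ) 1, M.a u ≤ α ∧ y = M.b u}

/-- `u*(α) = sup{u ∈ [0,1] : a(u) ≤ α}`. -/
noncomputable def ustar (α : ℝ) : ℝ :=
  sSup {u | u ∈ Set.Icc (0 : ℝ) 1 ∧ M.a u ≤ α}

/-- `b**(α) = inf{E[b(U)] : U a [0,1]-valued random variable with E[a(U)] ≤ α}`. -/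
noncomputable def bstarstar (α : ℝ) : ℝ :=
  sInf {y | ∃ ρ : Measure ℝ, IsProbabilityMeasure ρ ∧ (∀ᵐ u ∂ρ, u ∈ Set.Icc (0 : ℝ) 1) ∧
    (∫ u, M.a u ∂ρ) ≤ α ∧ y = ∫ u, M.b u ∂ρ}

end Model

/-- The Bernoulli(p) measure on `Bool`. -/
noncomputable def bern (p : ℝ) : Measure Bool :=
  (ENNReal.ofReal p) • Measure.dirac true + (ENNReal.ofReal (1 - p)) • Measure.dirac false

namespace Model

variable {𝒳 : Type*} [MeasurableSpace 𝒳] (M : Model 𝒳)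

/-- The per-observation rejection probability of the Neyman–Pearson rule at level `α`:
reject if `Lfdr(x) < G^{-1}(u*(α))`, randomize with probability `p(u*(α))` at equality,
and accept otherwise. -/
noncomputable def qNP (α : ℝ) (x : 𝒳) : ℝ :=
  if M.Lfdr x < M.Ginv (M.ustar α) then 1
  else if M.Lfdr x = M.Ginv (M.ustar α) then M.pu (M.ustar α)
  else 0

/-- The Neyman–Pearson rule `δ^n_NP(α)`, as a Markov kernel: independent randomized
likelihood-ratio tests applied to each observation. -/
noncomputable def NP (α : ℝ) (n : ℕ) : (Fin n → 𝒳) → Measure (Fin n → Bool) :=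
  fun x => Measure.pi fun i => bern (M.qNP α (x i))

/-- The probability (over data and the randomization of the rule `κ`) that the decision vector
lies in the set `E θ` (which may depend on the true labels `θ`). -/
noncomputable def prob (n : ℕ) (κ : (Fin n → 𝒳) → Measure (Fin n → Bool))
    (E : (Fin n → Bool) → Set (Fin n → Bool)) : ℝ :=
  (∫⁻ ω, κ (fun i => (ω i).2) (E fun i => (ω i).1) ∂(M.jointN n)).toReal

end Model

/-- `sortedVal n w i` is the `i`-th order statistic `w_(i)` (for `1 ≤ i ≤ n`) of
`w 0, …, w (n-1)`. -/
noncomputable def sortedVal (n : ℕ) (w : Fin n → ℝ) (i : ℕ) : ℝ :=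
  ((Multiset.map w Finset.univ.val).sort (· ≤ ·)).getD (i - 1) 0

/-- `avgLow n w k = (1/k) Σ_{i=1}^k w_(i)` (equal to `0` when `k = 0`). -/
noncomputable def avgLow (n : ℕ) (w : Fin n → ℝ) (k : ℕ) : ℝ :=
  (∑ i ∈ Finset.Icc 1 k, sortedVal n w i) / k

/-- `avgHigh n w k = (1/(n-k)) Σ_{i=k+1}^n (1 - w_(i))` (equal to `0` when `k = n`). -/
noncomputable def avgHigh (n : ℕ) (w : Fin n → ℝ) (k : ℕ) : ℝ :=
  (∑ i ∈ Finset.Icc (k + 1) n, (1 - sortedVal n w i)) / ((n : ℝ) - k)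

/-- The greatest convex minorant on `[0,1]` of a function `h`, evaluated at `α`. -/
noncomputable def gcm (h : ℝ → ℝ) (α : ℝ) : ℝ :=
  sSup {y | ∃ C : ℝ → ℝ, ConvexOn ℝ (Set.Icc 0 1) C ∧
    (∀ t ∈ Set.Icc (0 : ℝ) 1, C t ≤ h t) ∧ y = C α}

end TwoGroup

namespace TwoGroup

namespace Model

variable {𝒳 : Type*} [MeasurableSpace 𝒳] (M : Model 𝒳)

lemma π1_pos : 0 < M.π1 := by
  have := M.π0_mem.2
  unfold π1
  linarith

lemma f_nonneg (x : 𝒳) : 0 ≤ M.f x :=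
  add_nonneg (mul_nonneg M.π0_mem.1.le (M.f0_nonneg x)) (mul_nonneg M.π1_pos.le (M.f1_nonneg x))

lemma f_measurable : Measurable M.f :=
  (M.f0_meas.const_mul _).add (M.f1_meas.const_mul _)

lemma Lfdr_measurable : Measurable M.Lfdr :=
  (M.f0_meas.const_mul _).div M.f_measurable

lemma Lfdr_nonneg (x : 𝒳) : 0 ≤ M.Lfdr x :=
  div_nonneg (mul_nonneg M.π0_mem.1.le (M.f0_nonneg x)) (M.f_nonneg x)

lemma Lfdr_le_one (x : 𝒳) : M.Lfdr x ≤ 1 :=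
  div_le_one_of_le₀ (le_add_of_nonneg_right (mul_nonneg M.π1_pos.le (M.f1_nonneg x)))
    (M.f_nonneg x)

lemma Lfdr_mul_f (x : 𝒳) : M.Lfdr x * M.f x = M.π0 * M.f0 x := by
  have h0 := mul_nonneg M.π0_mem.1.le (M.f0_nonneg x)
  have h1 := mul_nonneg M.π1_pos.le (M.f1_nonneg x)
  rcases eq_or_ne (M.f x) 0 with h | h
  · have : M.π0 * M.f0 x + M.π1 * M.f1 x = 0 := h
    rw [h]
    linarith
  · exact div_mul_cancel₀ _ h

lemma Pmix_eq : M.Pmix =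
    ENNReal.ofReal M.π0 • M.base.withDensity (fun x => ENNReal.ofReal (M.f0 x)) +
      ENNReal.ofReal M.π1 • M.base.withDensity (fun x => ENNReal.ofReal (M.f1 x)) := by
  have m0 : Measurable fun x => ENNReal.ofReal (M.f0 x) := M.f0_meas.ennreal_ofReal
  have m1 : Measurable fun x => ENNReal.ofReal (M.f1 x) := M.f1_meas.ennreal_ofReal
  rw [← withDensity_smul _ m0, ← withDensity_smul _ m1,
    ← withDensity_add_left (m0.const_smul _), Pmix]
  congr 1
  ext x
  simp only [f, Pi.add_apply, Pi.smul_apply, smul_eq_mul]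
  rw [ENNReal.ofReal_add (mul_nonneg M.π0_mem.1.le (M.f0_nonneg x))
    (mul_nonneg M.π1_pos.le (M.f1_nonneg x)), ENNReal.ofReal_mul M.π0_mem.1.le,
    ENNReal.ofReal_mul M.π1_pos.le]

lemma ofReal_π0_add_π1 : ENNReal.ofReal M.π0 + ENNReal.ofReal M.π1 = 1 := by
  rw [← ENNReal.ofReal_add M.π0_mem.1.le M.π1_pos.le]
  simp [π1]

instance : IsProbabilityMeasure M.Pmix := by
  have h0 := M.f0_prob
  have h1 := M.f1_prob
  refine ⟨?_⟩
  rw [Pmix_eq, Measure.add_apply, Measure.smul_apply, Measure.smul_apply, measure_univ,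
    measure_univ]
  simpa using M.ofReal_π0_add_π1

instance : IsProbabilityMeasure M.νW :=
  Measure.isProbabilityMeasure_map M.Lfdr_measurable.aemeasurable

instance : IsProbabilityMeasure M.joint := by
  have h0 := M.f0_prob
  have h1 := M.f1_prob
  refine ⟨?_⟩
  rw [joint, Measure.add_apply, Measure.smul_apply, Measure.smul_apply, measure_univ,
    measure_univ]
  simpa using M.ofReal_π0_add_π1

instance (n : ℕ) : IsProbabilityMeasure (M.jointN n) := by
  unfold jointN
  infer_instance

lemma map_snd_joint : M.joint.map Prod.snd = M.Pmix := by
  have h0 := M.f0_prob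
  have h1 := M.f1_prob
  rw [Pmix_eq, joint, Measure.map_add _ _ measurable_snd, Measure.map_smul, Measure.map_smul,
    Measure.map_snd_prod, Measure.map_snd_prod]
  simp

lemma νW_mem_Icc : ∀ᵐ w ∂M.νW, w ∈ Set.Icc (0 : ℝ) 1 := by
  refine (ae_map_iff M.Lfdr_measurable.aemeasurable measurableSet_Icc).2 ?_
  exact ae_of_all _ fun x => ⟨M.Lfdr_nonneg x, M.Lfdr_le_one x⟩

lemma νW_compl_Icc : M.νW (Set.Icc (0 : ℝ) 1)ᶜ = 0 := M.νW_mem_Icc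

lemma integrable_id_νW : Integrable (fun w => w) M.νW := by
  refine Integrable.of_bound measurable_id.aestronglyMeasurable 1 ?_
  filter_upwards [M.νW_mem_Icc] with w hw
  simpa [abs_of_nonneg hw.1] using hw.2

lemma integral_jointN_comp_Lfdr {n : ℕ} (i : Fin n) {ψ : ℝ → ℝ} (hψ : Measurable ψ) :
    ∫ ω, ψ (M.Lfdr (ω i).2) ∂M.jointN n = ∫ w, ψ w ∂M.νW := by
  have h : (M.jointN n).map (fun ω => (ω i).2) = M.Pmix := by
    have := (measurePreserving_eval (fun _ : Fin n => M.joint) i).map_eq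
    rw [← map_snd_joint, ← this, Measure.map_map measurable_snd (measurable_pi_apply i)]
    rfl
  have hm : Measurable fun ω : Fin n → Bool × 𝒳 => (ω i).2 :=
    measurable_snd.comp (measurable_pi_apply i)
  rw [νW, ← h, integral_map M.Lfdr_measurable.aemeasurable hψ.aestronglyMeasurable,
    integral_map (f := fun x => ψ (M.Lfdr x)) hm.aemeasurable
      (hψ.comp M.Lfdr_measurable).aestronglyMeasurable]

lemma integral_joint_null_sub_Lfdr {g : 𝒳 → ℝ} (hg : Measurable g) {C : ℝ}
    (hC : ∀ x, |g x| ≤ C) :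
    ∫ z, g z.2 * ((if z.1 then (0 : ℝ) else 1) - M.Lfdr z.2) ∂M.joint = 0 := by
  have h0 := M.f0_prob
  have h1 := M.f1_prob
  have hL := M.Lfdr_measurable
  set F : Bool × 𝒳 → ℝ := fun z => g z.2 * ((if z.1 then (0 : ℝ) else 1) - M.Lfdr z.2) with hF
  have hFm : Measurable F := by
    have : Measurable fun b : Bool => if b then (0 : ℝ) else 1 := measurable_of_finite _
    exact (hg.comp measurable_snd).mul ((this.comp measurable_fst).sub (hL.comp measurable_snd))
  have hFb : ∀ z, ‖F z‖ ≤ C := by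
    rintro ⟨b, x⟩
    have a0 := M.Lfdr_nonneg x
    have a1 := M.Lfdr_le_one x
    have : |(if b then (0 : ℝ) else 1) - M.Lfdr x| ≤ 1 := by
      cases b <;> simp [abs_le] <;> constructor <;> linarith
    rw [Real.norm_eq_abs, hF]
    simp only [abs_mul]
    exact (mul_le_of_le_one_right (abs_nonneg _) this).trans (hC x)
  have hint : ∀ (ρ : Measure (Bool × 𝒳)) [IsFiniteMeasure ρ], Integrable F ρ := fun ρ _ =>
    Integrable.of_bound hFm.aestronglyMeasurable C (ae_of_all _ hFb)
  rw [joint, integral_add_measure ((hint _).smul_measure ENNReal.ofReal_ne_top)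
    ((hint _).smul_measure ENNReal.ofReal_ne_top), integral_smul_measure, integral_smul_measure,
    Measure.dirac_prod, Measure.dirac_prod,
    integral_map measurable_prodMk_left.aemeasurable hFm.aestronglyMeasurable,
    integral_map measurable_prodMk_left.aemeasurable hFm.aestronglyMeasurable,
    integral_withDensity_eq_integral_toReal_smul M.f0_meas.ennreal_ofReal (by simp),
    integral_withDensity_eq_integral_toReal_smul M.f1_meas.ennreal_ofReal (by simp),
    ENNReal.toReal_ofReal M.π0_mem.1.le, ENNReal.toReal_ofReal M.π1_pos.le, smul_eq_mul,
    smul_eq_mul, ← integral_const_mul, ← integral_const_mul, ← eq_neg_iff_add_eq_zero,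
    ← integral_neg]
  congr 1
  ext x
  have key : M.Lfdr x * (M.π0 * M.f0 x + M.π1 * M.f1 x) = M.π0 * M.f0 x := M.Lfdr_mul_f x
  simp only [hF, ENNReal.toReal_ofReal (M.f0_nonneg x), ENNReal.toReal_ofReal (M.f1_nonneg x),
    smul_eq_mul]
  simp only [Bool.false_eq_true, if_false, if_true]
  linear_combination (- g x) * key

/-- Given the observations, the label of the `i`-th hypothesis is null with conditional
probability `Lfdr (X i)`. -/
lemma integral_jointN_null {n : ℕ} (i : Fin n) {h : (Fin n → 𝒳) → ℝ} (hh : Measurable h) {C : ℝ}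
    (hC : ∀ x, |h x| ≤ C) :
    ∫ ω, h (fun j => (ω j).2) * (if (ω i).1 then (0 : ℝ) else 1) ∂M.jointN n =
      ∫ ω, h (fun j => (ω j).2) * M.Lfdr (ω i).2 ∂M.jointN n := by
  have hL := M.Lfdr_measurable
  have hX : Measurable fun ω : Fin n → Bool × 𝒳 => fun j => (ω j).2 :=
    measurable_pi_lambda _ fun j => measurable_snd.comp (measurable_pi_apply j)
  have hnull : Measurable fun b : Bool => if b then (0 : ℝ) else 1 := measurable_of_finite _
  have m1 : Measurable fun ω : Fin n → Bool × 𝒳 =>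
      h (fun j => (ω j).2) * (if (ω i).1 then (0 : ℝ) else 1) :=
    (hh.comp hX).mul (hnull.comp (measurable_fst.comp (measurable_pi_apply i)))
  have m2 : Measurable fun ω : Fin n → Bool × 𝒳 => h (fun j => (ω j).2) * M.Lfdr (ω i).2 :=
    (hh.comp hX).mul (hL.comp (measurable_snd.comp (measurable_pi_apply i)))
  have i1 : Integrable (fun ω : Fin n → Bool × 𝒳 =>
      h (fun j => (ω j).2) * (if (ω i).1 then (0 : ℝ) else 1)) (M.jointN n) := by
    refine Integrable.of_bound m1.aestronglyMeasurable C (ae_of_all _ fun ω => ?_)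
    rw [Real.norm_eq_abs, abs_mul]
    refine (mul_le_of_le_one_right (abs_nonneg _) ?_).trans (hC _)
    split_ifs <;> simp
  have i2 : Integrable (fun ω : Fin n → Bool × 𝒳 =>
      h (fun j => (ω j).2) * M.Lfdr (ω i).2) (M.jointN n) := by
    refine Integrable.of_bound m2.aestronglyMeasurable C (ae_of_all _ fun ω => ?_)
    rw [Real.norm_eq_abs, abs_mul]
    refine (mul_le_of_le_one_right (abs_nonneg _) ?_).trans (hC _)
    rw [abs_of_nonneg (M.Lfdr_nonneg _)]
    exact M.Lfdr_le_one _
  rw [← sub_eq_zero, ← integral_sub i1 i2]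
  obtain ⟨m, rfl⟩ : ∃ m, n = m + 1 := ⟨n - 1, by have := i.pos; omega⟩
  have hp := (measurePreserving_piFinSuccAbove (fun _ : Fin (m + 1) => M.joint) i).symm
  have i3 := (hp.integrable_comp (i1.sub i2).aestronglyMeasurable).2 (i1.sub i2)
  unfold jointN
  rw [← hp.integral_comp']
  refine (integral_prod_symm _ i3).trans ?_
  refine integral_eq_zero_of_ae (ae_of_all _ fun y => ?_)
  have key := M.integral_joint_null_sub_Lfdr
    (g := fun x => h (i.insertNth x fun j => (y j).2)) (C := C)
    (hh.comp (by
      refine measurable_pi_lambda _ fun j => ?_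
      refine Fin.succAboveCases i ?_ (fun k => ?_) j
      · simpa using measurable_id'
      · simp)) (fun x => hC _)
  refine Eq.trans (integral_congr_ae (ae_of_all _ fun z => ?_)) key
  have e : (fun j => ((MeasurableEquiv.piFinSuccAbove (fun _ => Bool × 𝒳) i).symm (z, y) j).2)
      = i.insertNth z.2 fun j => (y j).2 := by
    funext j
    refine Fin.succAboveCases i ?_ (fun k => ?_) j
    · simp [MeasurableEquiv.piFinSuccAbove_symm_apply]
    · simp [MeasurableEquiv.piFinSuccAbove_symm_apply]
  have e' : (MeasurableEquiv.piFinSuccAbove (fun _ => Bool × 𝒳) i).symm (z, y) i = z := by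
    simp [MeasurableEquiv.piFinSuccAbove_symm_apply]
  simp only [Function.comp_apply, Pi.sub_apply, e, e']
  ring

lemma G_eq_cdf (t : ℝ) : M.G t = cdf M.νW t := (cdf_eq_real M.νW t).symm

lemma G_eq_Gbar_add_atom (t : ℝ) : M.G t = M.Gbar t + M.atom t := by
  rw [G, Gbar, atom, ← ENNReal.toReal_add (measure_ne_top _ _) (measure_ne_top _ _),
    ← measure_union (by simp) (measurableSet_singleton t), Set.Iio_union_right]

lemma Gbar_zero : M.Gbar 0 = 0 := by
  have : M.νW (Set.Iio 0) = 0 :=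
    measure_mono_null (t := (Set.Icc 0 1)ᶜ) (fun w hw hw' => not_le.2 hw hw'.1) M.νW_compl_Icc
  simp [Gbar, this]

lemma G_eq_zero_of_neg {t : ℝ} (ht : t < 0) : M.G t = 0 := by
  have : M.νW (Set.Iic t) = 0 :=
    measure_mono_null (t := (Set.Icc 0 1)ᶜ) (fun w hw hw' => not_le.2 (lt_of_le_of_lt hw ht) hw'.1) M.νW_compl_Icc
  simp [G, this]

lemma G_one : M.G 1 = 1 := by
  have : M.νW (Set.Iic 1) = 1 :=
    (prob_compl_eq_zero_iff measurableSet_Iic).1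
      (measure_mono_null (t := (Set.Icc 0 1)ᶜ) (fun w hw hw' => hw hw'.2) M.νW_compl_Icc)
  simp [G, this]

lemma Gbar_le_of_forall_lt {t u : ℝ} (h : ∀ s < t, M.G s ≤ u) : M.Gbar t ≤ u := by
  have hlim := (monotone_cdf M.νW).tendsto_leftLim t
  have hle : Function.leftLim (cdf M.νW) t ≤ u :=
    le_of_tendsto hlim (eventually_mem_nhdsWithin.mono fun s hs => M.G_eq_cdf s ▸ h s hs)
  have h0 : 0 ≤ Function.leftLim (cdf M.νW) t :=
    ge_of_tendsto hlim (Eventually.of_forall fun s => cdf_nonneg _ s)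
  have hG : M.νW (Set.Iio t) = ENNReal.ofReal (Function.leftLim (cdf M.νW) t - 0) := by
    rw [← (cdf M.νW).measure_Iio (tendsto_cdf_atBot _) t, measure_cdf]
  rw [Gbar, hG, sub_zero, ENNReal.toReal_ofReal h0]
  exact hle

lemma le_G_of_forall_gt {t u : ℝ} (h : ∀ s > t, u ≤ M.G s) : u ≤ M.G t := by
  have hlim : Tendsto (cdf M.νW) (nhdsWithin t (Set.Ioi t)) (nhds (cdf M.νW t)) :=
    ((cdf M.νW).right_continuous t).mono_left (nhdsWithin_mono _ Set.Ioi_subset_Ici_self)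
  rw [G_eq_cdf]
  exact ge_of_tendsto hlim (eventually_mem_nhdsWithin.mono fun s hs => M.G_eq_cdf s ▸ h s hs)

lemma Ginv_zero : M.Ginv 0 = 0 := by
  have : {t | 0 ≤ M.G t} = Set.univ := Set.eq_univ_of_forall fun t => ENNReal.toReal_nonneg
  rw [Ginv, this, Real.sInf_univ]

lemma Gbar_Ginv_le {u : ℝ} (hu : u ∈ Set.Icc (0 : ℝ) 1) : M.Gbar (M.Ginv u) ≤ u := by
  rcases hu.1.eq_or_lt with rfl | h0
  · rw [Ginv_zero, Gbar_zero]
  · refine M.Gbar_le_of_forall_lt fun s hs => ?_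
    by_contra! hlt
    have hbdd : BddBelow {t | u ≤ M.G t} := by
      refine ⟨0, fun t ht => ?_⟩
      by_contra! htn
      exact absurd (M.G_eq_zero_of_neg htn ▸ ht : u ≤ 0) (not_le.2 h0)
    exact not_le.2 hs (csInf_le hbdd hlt.le)

lemma le_G_Ginv {u : ℝ} (hu : u ∈ Set.Icc (0 : ℝ) 1) : u ≤ M.G (M.Ginv u) := by
  rcases hu.1.eq_or_lt with rfl | h0
  · exact ENNReal.toReal_nonneg
  · refine M.le_G_of_forall_gt fun s hs => ?_
    have hne : {t | u ≤ M.G t}.Nonempty := ⟨1, hu.2.trans_eq M.G_one.symm⟩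
    obtain ⟨t, ht, hts⟩ := exists_lt_of_csInf_lt hne hs
    rw [G_eq_cdf]
    exact (M.G_eq_cdf t ▸ ht : u ≤ cdf M.νW t).trans (monotone_cdf _ hts.le)

lemma Gbar_add_pu_mul_atom {u : ℝ} (hu : u ∈ Set.Icc (0 : ℝ) 1) :
    M.Gbar (M.Ginv u) + M.pu u * M.atom (M.Ginv u) = u := by
  have h1 := M.Gbar_Ginv_le hu
  have h2 := M.le_G_Ginv hu
  rw [G_eq_Gbar_add_atom] at h2
  rcases eq_or_ne (M.atom (M.Ginv u)) 0 with h | h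
  · rw [h] at h2 ⊢
    linarith
  · rw [pu, div_mul_cancel₀ _ h]
    ring

lemma pu_mem_Icc {u : ℝ} (hu : u ∈ Set.Icc (0 : ℝ) 1) : M.pu u ∈ Set.Icc (0 : ℝ) 1 := by
  have h1 := M.Gbar_Ginv_le hu
  have h2 := M.le_G_Ginv hu
  rw [G_eq_Gbar_add_atom] at h2
  exact ⟨div_nonneg (by linarith) ENNReal.toReal_nonneg,
    div_le_one_of_le₀ (by linarith) ENNReal.toReal_nonneg⟩

/-- The rejection probability of the thresholding variable `S_u` given `W = w`. -/
noncomputable def npTest (u w : ℝ) : ℝ :=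
  if w < M.Ginv u then 1 else if w = M.Ginv u then M.pu u else 0

lemma npTest_eq_indicator (u w : ℝ) : M.npTest u w =
    (Set.Iio (M.Ginv u)).indicator (fun _ => 1) w +
      ({M.Ginv u} : Set ℝ).indicator (fun _ => M.pu u) w := by
  rcases lt_trichotomy w (M.Ginv u) with h | h | h
  · simp [npTest, h, h.ne]
  · simp [npTest, h]
  · simp [npTest, h.ne', h.not_gt]

lemma npTest_measurable (u : ℝ) : Measurable (M.npTest u) :=
  Measurable.ite measurableSet_Iio measurable_const
    (Measurable.ite (measurableSet_singleton _) measurable_const measurable_const)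

lemma npTest_mem_Icc {u : ℝ} (hu : u ∈ Set.Icc (0 : ℝ) 1) (w : ℝ) :
    M.npTest u w ∈ Set.Icc (0 : ℝ) 1 := by
  unfold npTest
  split_ifs
  · simp
  · exact M.pu_mem_Icc hu
  · simp

/-- Pointwise form of the Neyman–Pearson lemma. -/
lemma npTest_mul_sub_le {u w r : ℝ} (hr : r ∈ Set.Icc (0 : ℝ) 1) :
    M.npTest u w * (w - M.Ginv u) ≤ r * (w - M.Ginv u) := by
  unfold npTest
  split_ifs with h h'
  · nlinarith [hr.2]
  · simp [h']
  · rw [zero_mul]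
    exact mul_nonneg hr.1 (sub_nonneg.2 (not_lt.1 h))

lemma integral_npTest_mul (u : ℝ) {g : ℝ → ℝ} (hg : Integrable g M.νW) :
    ∫ w, g w * M.npTest u w ∂M.νW =
      (∫ w in Set.Iio (M.Ginv u), g w ∂M.νW) +
        M.pu u * (g (M.Ginv u) * M.atom (M.Ginv u)) := by
  have e : (fun w => g w * M.npTest u w) = fun w => (Set.Iio (M.Ginv u)).indicator g w +
      ({M.Ginv u} : Set ℝ).indicator (fun w => g w * M.pu u) w := by
    funext w
    rw [npTest_eq_indicator]
    simp only [Set.indicator_apply]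
    split_ifs <;> ring
  rw [e, integral_add (hg.indicator measurableSet_Iio)
    ((hg.mul_const _).indicator (measurableSet_singleton _)),
    integral_indicator measurableSet_Iio, integral_indicator (measurableSet_singleton _),
    integral_singleton]
  simp only [Measure.real, atom, smul_eq_mul]
  ring

lemma integral_npTest {u : ℝ} (hu : u ∈ Set.Icc (0 : ℝ) 1) :
    ∫ w, M.npTest u w ∂M.νW = u := by
  have h := M.integral_npTest_mul u (integrable_const (1 : ℝ))
  simp only [one_mul, setIntegral_const, smul_eq_mul, mul_one] at h
  exact h.trans (M.Gbar_add_pu_mul_atom hu)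

/-- `lowMass u = E[W S_u]`. -/
noncomputable def lowMass (u : ℝ) : ℝ := ∫ w, w * M.npTest u w ∂M.νW

lemma a_eq (u : ℝ) : M.a u = M.lowMass u / u := by
  rw [lowMass, M.integral_npTest_mul u M.integrable_id_νW, a]
  split_ifs with h
  · simp [h]
  · rfl

lemma integrable_npTest {u : ℝ} (hu : u ∈ Set.Icc (0 : ℝ) 1) :
    Integrable (M.npTest u) M.νW :=
  Integrable.of_bound (M.npTest_measurable u).aestronglyMeasurable 1 (ae_of_all _ fun w => by
    rw [Real.norm_eq_abs, abs_of_nonneg (M.npTest_mem_Icc hu w).1]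
    exact (M.npTest_mem_Icc hu w).2)

lemma integrable_mul_npTest {u : ℝ} (hu : u ∈ Set.Icc (0 : ℝ) 1) :
    Integrable (fun w => w * M.npTest u w) M.νW :=
  M.integrable_id_νW.mul_bdd (c := 1) (M.npTest_measurable u).aestronglyMeasurable
    (ae_of_all _ fun w => by
      rw [Real.norm_eq_abs, abs_of_nonneg (M.npTest_mem_Icc hu w).1]
      exact (M.npTest_mem_Icc hu w).2)

lemma b_eq {u : ℝ} (hu : u ∈ Set.Icc (0 : ℝ) 1) :
    M.b u = (1 - (∫ w, w ∂M.νW) - u + M.lowMass u) / (1 - u) := by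
  rw [b]
  split_ifs with h
  · simp [h]
  congr 1
  have hg : Integrable (fun w => 1 - w) M.νW := (integrable_const 1).sub M.integrable_id_νW
  have e : (∫ w, (1 - w) * M.npTest u w ∂M.νW) = u - M.lowMass u := by
    simp_rw [sub_mul, one_mul]
    rw [integral_sub (M.integrable_npTest hu) (M.integrable_mul_npTest hu),
      M.integral_npTest hu, lowMass]
  have e1 : ∫ w, (1 - w) ∂M.νW = 1 - ∫ w, w ∂M.νW := by
    rw [integral_sub (integrable_const 1) M.integrable_id_νW]
    simp
  have e2 : ∫ w, (1 - w) ∂M.νW = (∫ w in Set.Iic (M.Ginv u), (1 - w) ∂M.νW) +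
      ∫ w in Set.Ioi (M.Ginv u), (1 - w) ∂M.νW := by
    rw [← Set.compl_Iic, integral_add_compl measurableSet_Iic hg]
  have e3 : ∫ w in Set.Iic (M.Ginv u), (1 - w) ∂M.νW =
      (∫ w in Set.Iio (M.Ginv u), (1 - w) ∂M.νW) +
        (1 - M.Ginv u) * M.atom (M.Ginv u) := by
    rw [← Set.Iio_union_right, setIntegral_union (by simp)
      (measurableSet_singleton _) hg.integrableOn hg.integrableOn, integral_singleton]
    simp only [Measure.real, atom, smul_eq_mul]
    ring
  have e4 := M.integral_npTest_mul u hg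
  linarith

lemma lowMass_sub_le {u v : ℝ} (hu : u ∈ Set.Icc (0 : ℝ) 1) (hv : v ∈ Set.Icc (0 : ℝ) 1) :
    M.lowMass u - M.Ginv u * u ≤ M.lowMass v - M.Ginv u * v := by
  have h : ∀ z ∈ Set.Icc (0 : ℝ) 1, M.lowMass z - M.Ginv u * z =
      ∫ w, M.npTest z w * (w - M.Ginv u) ∂M.νW := by
    intro z hz
    nth_rewrite 2 [← M.integral_npTest hz]
    rw [lowMass, ← integral_const_mul, ← integral_sub (M.integrable_mul_npTest hz)
      ((M.integrable_npTest hz).const_mul _)]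
    congr 1
    ext w
    ring
  have hi : ∀ z ∈ Set.Icc (0 : ℝ) 1,
      Integrable (fun w => M.npTest z w * (w - M.Ginv u)) M.νW := by
    intro z hz
    refine ((M.integrable_mul_npTest hz).sub
      ((M.integrable_npTest hz).const_mul (M.Ginv u))).congr (ae_of_all _ fun w => ?_)
    simp only [Pi.sub_apply]
    ring
  rw [h u hu, h v hv]
  exact integral_mono (hi u hu) (hi v hv) fun w => M.npTest_mul_sub_le (M.npTest_mem_Icc hv w)

lemma lowMass_le {u : ℝ} (hu : u ∈ Set.Icc (0 : ℝ) 1) : M.lowMass u ≤ u := by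
  nth_rewrite 2 [← M.integral_npTest hu]
  refine integral_mono_ae (M.integrable_mul_npTest hu) (M.integrable_npTest hu) ?_
  filter_upwards [M.νW_mem_Icc] with w hw
  exact mul_le_of_le_one_left (M.npTest_mem_Icc hu w).1 hw.2

lemma a_le_iff {u α : ℝ} (hu : u ∈ Set.Icc (0 : ℝ) 1) (hα : 0 ≤ α) :
    M.a u ≤ α ↔ M.lowMass u ≤ α * u := by
  rw [a_eq]
  rcases hu.1.eq_or_lt with rfl | h
  · have := M.lowMass_le hu
    simp [hα, this]
  · exact div_le_iff₀ h

lemma ustar_mem_Icc {α : ℝ} (hα : 0 ≤ α) : M.ustar α ∈ Set.Icc (0 : ℝ) 1 := by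
  have h0 : (0 : ℝ) ∈ {u | u ∈ Set.Icc (0 : ℝ) 1 ∧ M.a u ≤ α} := by simp [a, hα]
  exact ⟨le_csSup ⟨1, fun _ hu => hu.1.2⟩ h0, csSup_le ⟨0, h0⟩ fun _ hu => hu.1.2⟩

lemma le_ustar {u α : ℝ} (hu : u ∈ Set.Icc (0 : ℝ) 1) (h : M.a u ≤ α) : u ≤ M.ustar α :=
  le_csSup ⟨1, fun _ hu => hu.1.2⟩ ⟨hu, h⟩

lemma a_ustar_le {α : ℝ} (hα : 0 ≤ α) : M.a (M.ustar α) ≤ α := by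
  have hs := M.ustar_mem_Icc hα
  rw [M.a_le_iff hs hα]
  have hne : {u | u ∈ Set.Icc (0 : ℝ) 1 ∧ M.a u ≤ α}.Nonempty := ⟨0, by simp [a, hα]⟩
  obtain ⟨v, -, hvlim, hv⟩ := exists_seq_tendsto_sSup hne ⟨1, fun _ hu => hu.1.2⟩
  have hlim : Tendsto v atTop (nhds (M.ustar α)) := hvlim
  have h1 : Tendsto (fun k => α * v k + M.Ginv (M.ustar α) * (M.ustar α - v k)) atTop
      (nhds (α * M.ustar α + M.Ginv (M.ustar α) * (M.ustar α - M.ustar α))) :=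
    (hlim.const_mul _).add ((tendsto_const_nhds.sub hlim).const_mul _)
  rw [sub_self, mul_zero, add_zero] at h1
  refine ge_of_tendsto' h1 fun k => ?_
  have h2 := M.lowMass_sub_le hs (hv k).1
  have h3 := (M.a_le_iff (hv k).1 hα).1 (hv k).2
  linarith

lemma lowMass_one : M.lowMass 1 = ∫ w, w ∂M.νW := by
  have h1 : ∀ᵐ w ∂M.νW, M.npTest 1 w = 1 := by
    have hi := M.integrable_npTest (u := 1) (by simp)
    have h2 : ∫ w, (1 - M.npTest 1 w) ∂M.νW = 0 := by
      rw [integral_sub (integrable_const 1) hi, M.integral_npTest (by simp)]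
      simp
    rw [integral_eq_zero_iff_of_nonneg
      (fun w => sub_nonneg.2 (M.npTest_mem_Icc (by simp) w).2)
      ((integrable_const 1).sub hi)] at h2
    filter_upwards [h2] with w hw
    exact (sub_eq_zero.1 hw).symm
  refine integral_congr_ae ?_
  filter_upwards [h1] with w hw
  rw [hw, mul_one]

/-- A rule with average rejection mass `U` and average null rejection mass `V` that meets the
mFDR constraint has mFNR at least `b (ustar α)`. -/
lemma b_ustar_le {α U V : ℝ} (hα : 0 ≤ α) (hU : U ∈ Set.Icc (0 : ℝ) 1)
    (hV : ∀ u ∈ Set.Icc (0 : ℝ) 1, M.lowMass u - M.Ginv u * u ≤ V - M.Ginv u * U)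
    (hVU : V ≤ α * U) (hn : 0 ≤ 1 - (∫ w, w ∂M.νW) - U + V) :
    M.b (M.ustar α) ≤ (1 - (∫ w, w ∂M.νW) - U + V) / (1 - U) := by
  have hs := M.ustar_mem_Icc hα
  have hUs : U ≤ M.ustar α := M.le_ustar hU
    ((M.a_le_iff hU hα).2 ((by linarith [hV U hU] : M.lowMass U ≤ V).trans hVU))
  rw [M.b_eq hs]
  rcases hs.2.eq_or_lt with h1 | h1
  · rw [h1]
    simpa using div_nonneg hn (sub_nonneg.2 hU.2)
  · have e1 := M.lowMass_sub_le hs (v := 1) (by simp)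
    have e2 := hV _ hs
    rw [lowMass_one] at e1
    rw [div_le_div_iff₀ (by linarith) (by linarith)]
    nlinarith [mul_le_mul_of_nonneg_right e1 (sub_nonneg.2 hUs),
      mul_le_mul_of_nonneg_right e2 (sub_nonneg.2 h1.le)]

lemma bstar_eq {α : ℝ} (hα : 0 ≤ α) : M.bstar α = M.b (M.ustar α) := by
  refine IsLeast.csInf_eq ⟨⟨_, M.ustar_mem_Icc hα, M.a_ustar_le hα, rfl⟩, ?_⟩
  rintro _ ⟨u, hu, hau, rfl⟩
  rw [M.b_eq hu]
  refine M.b_ustar_le hα hu (fun v hv => M.lowMass_sub_le hv hu) ((M.a_le_iff hu hα).1 hau) ?_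
  have h : 0 ≤ ∫ w, (1 - w) * (1 - M.npTest u w) ∂M.νW := by
    refine integral_nonneg_of_ae ?_
    filter_upwards [M.νW_mem_Icc] with w hw
    exact mul_nonneg (sub_nonneg.2 hw.2) (sub_nonneg.2 (M.npTest_mem_Icc hu w).2)
  have e : ∫ w, (1 - w) * (1 - M.npTest u w) ∂M.νW =
      1 - (∫ w, w ∂M.νW) - (u - M.lowMass u) := by
    have h1 : (fun w => (1 - w) * (1 - M.npTest u w)) =
        fun w => (1 - w) - (M.npTest u w - w * M.npTest u w) := by
      funext w
      ring
    have i1 : Integrable (fun w => 1 - w) M.νW := (integrable_const 1).sub M.integrable_id_νW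
    have i2 : Integrable (fun w => M.npTest u w - w * M.npTest u w) M.νW :=
      (M.integrable_npTest hu).sub (M.integrable_mul_npTest hu)
    rw [h1, integral_sub i1 i2,
      integral_sub (integrable_const 1) M.integrable_id_νW,
      integral_sub (M.integrable_npTest hu) (M.integrable_mul_npTest hu),
      M.integral_npTest hu, lowMass]
    simp
  linarith

end Model

section DecisionCounts

variable {n : ℕ} (ρ : Measure (Fin n → Bool))

lemma integral_reject (i : Fin n) :
    ∫ d, (if d i then (1 : ℝ) else 0) ∂ρ = ρ.real {d | d i = true} := by
  rw [← integral_indicator_one (Set.toFinite _).measurableSet]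
  congr 1
  ext d
  simp [Set.indicator_apply]

variable [IsProbabilityMeasure ρ]

lemma integral_accept (i : Fin n) :
    ∫ d, (if d i then (0 : ℝ) else 1) ∂ρ = 1 - ρ.real {d | d i = true} := by
  have e : (fun d : Fin n → Bool => if d i then (0 : ℝ) else 1) =
      fun d => 1 - (if d i then (1 : ℝ) else 0) := by
    funext d
    split_ifs <;> simp
  rw [e, integral_sub Integrable.of_finite Integrable.of_finite, integral_reject]
  simp

lemma integral_nRej : ∫ d, nRej d ∂ρ = ∑ i, ρ.real {d | d i = true} := by
  simp only [nRej]
  rw [integral_finsetSum _ fun _ _ => Integrable.of_finite]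
  simp only [integral_reject]

lemma integral_nFD (θ : Fin n → Bool) :
    ∫ d, nFD θ d ∂ρ = ∑ i, ρ.real {d | d i = true} * (if θ i then (0 : ℝ) else 1) := by
  simp only [nFD]
  rw [integral_finsetSum _ fun _ _ => Integrable.of_finite]
  simp only [integral_mul_const, integral_reject]

lemma integral_nAcc : ∫ d, nAcc d ∂ρ = ∑ i, (1 - ρ.real {d | d i = true}) := by
  simp only [nAcc]
  rw [integral_finsetSum _ fun _ _ => Integrable.of_finite]
  simp only [integral_accept]

lemma integral_nFN (θ : Fin n → Bool) :
    ∫ d, nFN θ d ∂ρ = ∑ i, (1 - ρ.real {d | d i = true}) * (if θ i then (1 : ℝ) else 0) := by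
  simp only [nFN]
  rw [integral_finsetSum _ fun _ _ => Integrable.of_finite]
  simp only [integral_mul_const, integral_accept]

end DecisionCounts

/-- The probability that a rule rejects the `i`-th hypothesis, given the observations. -/
noncomputable def rejProb {𝒳 : Type*} {n : ℕ} (κ : (Fin n → 𝒳) → Measure (Fin n → Bool))
    (i : Fin n) (x : Fin n → 𝒳) : ℝ :=
  (κ x).real {d | d i = true}

section Rules

variable {𝒳 : Type*} [MeasurableSpace 𝒳] {n : ℕ} {κ : (Fin n → 𝒳) → Measure (Fin n → Bool)}

lemma IsRule.rejProb_measurable (hκ : IsRule κ) (i : Fin n) : Measurable (rejProb κ i) :=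
  ((Measure.measurable_coe (Set.toFinite _).measurableSet).comp hκ.1).ennreal_toReal

lemma IsRule.rejProb_mem_Icc (hκ : IsRule κ) (i : Fin n) (x : Fin n → 𝒳) :
    rejProb κ i x ∈ Set.Icc (0 : ℝ) 1 := by
  have := hκ.2 x
  exact ⟨measureReal_nonneg, measureReal_le_one⟩

end Rules

namespace Model

variable {𝒳 : Type*} [MeasurableSpace 𝒳] (M : Model 𝒳)

/-- The expected number of rejections of a rule. -/
noncomputable def rejMass (n : ℕ) (κ : (Fin n → 𝒳) → Measure (Fin n → Bool)) : ℝ :=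
  ∑ i, ∫ ω, rejProb κ i (fun j => (ω j).2) ∂M.jointN n

/-- The expected number of false rejections of a rule. -/
noncomputable def nullMass (n : ℕ) (κ : (Fin n → 𝒳) → Measure (Fin n → Bool)) : ℝ :=
  ∑ i, ∫ ω, rejProb κ i (fun j => (ω j).2) * M.Lfdr (ω i).2 ∂M.jointN n

section Masses

variable {n : ℕ} {κ : (Fin n → 𝒳) → Measure (Fin n → Bool)}

lemma integrable_jointN_of_abs_le_one {F : (Fin n → Bool × 𝒳) → ℝ} (hF : Measurable F)
    (hb : ∀ ω, |F ω| ≤ 1) : Integrable F (M.jointN n) :=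
  Integrable.of_bound hF.aestronglyMeasurable 1 (ae_of_all _ hb)

lemma measurable_observations :
    Measurable fun (ω : Fin n → Bool × 𝒳) (j : Fin n) => (ω j).2 :=
  measurable_pi_lambda _ fun j => measurable_snd.comp (measurable_pi_apply j)

lemma measurable_Lfdr_observation (i : Fin n) :
    Measurable fun ω : Fin n → Bool × 𝒳 => M.Lfdr (ω i).2 :=
  M.Lfdr_measurable.comp (measurable_snd.comp (measurable_pi_apply i))

lemma integrable_rejProb (hκ : IsRule κ) (i : Fin n) :
    Integrable (fun ω => rejProb κ i fun j => (ω j).2) (M.jointN n) := by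
  refine M.integrable_jointN_of_abs_le_one
    ((hκ.rejProb_measurable i).comp measurable_observations) fun ω => ?_
  rw [abs_of_nonneg (hκ.rejProb_mem_Icc i _).1]
  exact (hκ.rejProb_mem_Icc i _).2

lemma integrable_Lfdr (i : Fin n) :
    Integrable (fun ω => M.Lfdr (ω i).2) (M.jointN n) := by
  refine M.integrable_jointN_of_abs_le_one (M.measurable_Lfdr_observation i) fun ω => ?_
  rw [abs_of_nonneg (M.Lfdr_nonneg _)]
  exact M.Lfdr_le_one _

lemma abs_mul_le_one {r s : ℝ} (hr : r ∈ Set.Icc (0 : ℝ) 1) (hs : s ∈ Set.Icc (0 : ℝ) 1) :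
    |r * s| ≤ 1 := by
  rw [abs_of_nonneg (mul_nonneg hr.1 hs.1)]
  exact mul_le_one₀ hr.2 hs.1 hs.2

lemma integrable_rejProb_mul_Lfdr (hκ : IsRule κ) (i : Fin n) :
    Integrable (fun ω => rejProb κ i (fun j => (ω j).2) * M.Lfdr (ω i).2) (M.jointN n) :=
  M.integrable_jointN_of_abs_le_one
    (((hκ.rejProb_measurable i).comp measurable_observations).mul
      (M.measurable_Lfdr_observation i))
    fun _ => abs_mul_le_one (hκ.rejProb_mem_Icc i _) ⟨M.Lfdr_nonneg _, M.Lfdr_le_one _⟩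

lemma measurable_null (i : Fin n) :
    Measurable fun ω : Fin n → Bool × 𝒳 => if (ω i).1 then (0 : ℝ) else 1 :=
  (measurable_of_finite fun b : Bool => if b then (0 : ℝ) else 1).comp
    (measurable_fst.comp (measurable_pi_apply i))

lemma integrable_rejProb_mul_null (hκ : IsRule κ) (i : Fin n) :
    Integrable (fun ω : Fin n → Bool × 𝒳 =>
      rejProb κ i (fun j => (ω j).2) * (if (ω i).1 then (0 : ℝ) else 1)) (M.jointN n) :=
  M.integrable_jointN_of_abs_le_one
    (((hκ.rejProb_measurable i).comp measurable_observations).mul (measurable_null i))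
    fun _ => abs_mul_le_one (hκ.rejProb_mem_Icc i _) (by split_ifs <;> simp)

lemma mFDR_eq (hκ : IsRule κ) : M.mFDR n κ = M.nullMass n κ / M.rejMass n κ := by
  have := hκ.2
  simp only [mFDR, integral_nFD, integral_nRej]
  congr 1
  · refine (integral_finsetSum _ fun i _ => M.integrable_rejProb_mul_null hκ i).trans ?_
    refine Finset.sum_congr rfl fun i _ => ?_
    refine M.integral_jointN_null i (hκ.rejProb_measurable i) (C := 1) fun x => ?_
    rw [abs_of_nonneg (hκ.rejProb_mem_Icc i x).1]
    exact (hκ.rejProb_mem_Icc i x).2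
  · exact integral_finsetSum _ fun i _ => M.integrable_rejProb hκ i

lemma integral_Lfdr (i : Fin n) :
    ∫ ω, M.Lfdr (ω i).2 ∂M.jointN n = ∫ w, w ∂M.νW :=
  M.integral_jointN_comp_Lfdr i measurable_id

lemma sum_integral_accept_eq (hκ : IsRule κ) :
    ∑ i, ∫ ω, (1 - rejProb κ i fun j => (ω j).2) * (1 - M.Lfdr (ω i).2) ∂M.jointN n =
      n - n * (∫ w, w ∂M.νW) - M.rejMass n κ + M.nullMass n κ := by
  have h : ∀ i : Fin n,
      ∫ ω, (1 - rejProb κ i fun j => (ω j).2) * (1 - M.Lfdr (ω i).2) ∂M.jointN n =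
        1 - (∫ w, w ∂M.νW) - (∫ ω, rejProb κ i (fun j => (ω j).2) ∂M.jointN n) +
          ∫ ω, rejProb κ i (fun j => (ω j).2) * M.Lfdr (ω i).2 ∂M.jointN n := by
    intro i
    have i1 := (integrable_const (μ := M.jointN n) (1 : ℝ)).sub (M.integrable_Lfdr i)
    have i2 := i1.sub (M.integrable_rejProb hκ i)
    have e : (fun ω : Fin n → Bool × 𝒳 =>
        (1 - rejProb κ i fun j => (ω j).2) * (1 - M.Lfdr (ω i).2)) =
        fun ω => 1 - M.Lfdr (ω i).2 - rejProb κ i (fun j => (ω j).2) +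
          rejProb κ i (fun j => (ω j).2) * M.Lfdr (ω i).2 := by
      funext ω
      ring
    rw [e]
    refine (integral_add i2 (M.integrable_rejProb_mul_Lfdr hκ i)).trans ?_
    congr 1
    refine (integral_sub i1 (M.integrable_rejProb hκ i)).trans ?_
    congr 1
    refine (integral_sub (integrable_const _) (M.integrable_Lfdr i)).trans ?_
    rw [M.integral_Lfdr i]
    simp
  rw [Finset.sum_congr rfl fun i _ => h i]
  simp only [Finset.sum_add_distrib, Finset.sum_sub_distrib, rejMass, nullMass]
  simp

lemma mFNR_eq (hκ : IsRule κ) : M.mFNR n κ =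
    (n - n * (∫ w, w ∂M.νW) - M.rejMass n κ + M.nullMass n κ) / (n - M.rejMass n κ) := by
  have := hκ.2
  simp only [mFNR, integral_nFN, integral_nAcc]
  rw [← M.sum_integral_accept_eq hκ]
  have hr : ∀ (i : Fin n) (x : Fin n → 𝒳), 1 - rejProb κ i x ∈ Set.Icc (0 : ℝ) 1 := fun i x =>
    ⟨sub_nonneg.2 (hκ.rejProb_mem_Icc i x).2, sub_le_self _ (hκ.rejProb_mem_Icc i x).1⟩
  have hm : ∀ i : Fin n, Measurable fun x => 1 - rejProb κ i x := fun i =>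
    (hκ.rejProb_measurable i).const_sub 1
  have i1 : ∀ i : Fin n, Integrable (fun ω => 1 - rejProb κ i fun j => (ω j).2) (M.jointN n) :=
    fun i => (integrable_const _).sub (M.integrable_rejProb hκ i)
  have iN : ∀ i : Fin n, Integrable (fun ω : Fin n → Bool × 𝒳 =>
      (1 - rejProb κ i fun j => (ω j).2) * (if (ω i).1 then (0 : ℝ) else 1)) (M.jointN n) :=
    fun i => M.integrable_jointN_of_abs_le_one
      (((hm i).comp measurable_observations).mul (measurable_null i))
      fun _ => abs_mul_le_one (hr i _) (by split_ifs <;> simp)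
  have iL : ∀ i : Fin n, Integrable (fun ω : Fin n → Bool × 𝒳 =>
      (1 - rejProb κ i fun j => (ω j).2) * M.Lfdr (ω i).2) (M.jointN n) :=
    fun i => M.integrable_jointN_of_abs_le_one
      (((hm i).comp measurable_observations).mul (M.measurable_Lfdr_observation i))
      fun _ => abs_mul_le_one (hr i _) ⟨M.Lfdr_nonneg _, M.Lfdr_le_one _⟩
  have e : ∀ i : Fin n, (fun ω : Fin n → Bool × 𝒳 =>
      (1 - rejProb κ i fun j => (ω j).2) * (if (ω i).1 then (1 : ℝ) else 0)) =
      fun ω => (1 - rejProb κ i fun j => (ω j).2) -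
        (1 - rejProb κ i fun j => (ω j).2) * (if (ω i).1 then (0 : ℝ) else 1) := by
    intro i
    funext ω
    split_ifs <;> ring
  congr 1
  · refine (integral_finsetSum (μ := M.jointN n) _ fun i _ => ?_).trans
      (Finset.sum_congr rfl fun i _ => ?_)
    · exact (congrArg (Integrable · (M.jointN n)) (e i)).mpr ((i1 i).sub (iN i))
    · refine (congrArg (fun F => ∫ ω, F ω ∂M.jointN n) (e i)).trans ?_
      refine (integral_sub (i1 i) (iN i)).trans ?_
      have hn := M.integral_jointN_null i (hm i) (C := 1) fun x => by
        rw [abs_of_nonneg (hr i x).1]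
        exact (hr i x).2
      rw [hn, ← integral_sub (i1 i) (iL i)]
      congr 1
      ext ω
      ring
  · refine (integral_finsetSum _ fun i _ => i1 i).trans ?_
    refine (Finset.sum_congr rfl fun i _ =>
      integral_sub (integrable_const _) (M.integrable_rejProb hκ i)).trans ?_
    simp [Finset.sum_sub_distrib, rejMass]

lemma rejMass_mem_Icc (hκ : IsRule κ) : M.rejMass n κ ∈ Set.Icc (0 : ℝ) n := by
  refine ⟨Finset.sum_nonneg fun i _ => integral_nonneg fun ω => (hκ.rejProb_mem_Icc i _).1, ?_⟩
  refine (Finset.sum_le_sum (g := fun _ => (1 : ℝ)) fun i _ => ?_).trans (by simp)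
  refine (integral_mono (M.integrable_rejProb hκ i) (integrable_const (1 : ℝ))
    fun ω => (hκ.rejProb_mem_Icc i _).2).trans (by simp)

lemma nullMass_le_rejMass (hκ : IsRule κ) : M.nullMass n κ ≤ M.rejMass n κ :=
  Finset.sum_le_sum fun i _ =>
    integral_mono (M.integrable_rejProb_mul_Lfdr hκ i) (M.integrable_rejProb hκ i) fun _ =>
      mul_le_of_le_one_right (hκ.rejProb_mem_Icc i _).1 (M.Lfdr_le_one _)

lemma acceptMass_nonneg (hκ : IsRule κ) :
    0 ≤ n - n * (∫ w, w ∂M.νW) - M.rejMass n κ + M.nullMass n κ := by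
  rw [← M.sum_integral_accept_eq hκ]
  exact Finset.sum_nonneg fun i _ => integral_nonneg fun ω =>
    mul_nonneg (sub_nonneg.2 (hκ.rejProb_mem_Icc i _).2) (sub_nonneg.2 (M.Lfdr_le_one _))

/-- Neyman–Pearson lemma for compound rules. -/
lemma lowMass_sub_le_nullMass (hκ : IsRule κ) {u : ℝ} (hu : u ∈ Set.Icc (0 : ℝ) 1) :
    n * (M.lowMass u - M.Ginv u * u) ≤ M.nullMass n κ - M.Ginv u * M.rejMass n κ := by
  have h : ∀ i : Fin n, M.lowMass u - M.Ginv u * u ≤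
      (∫ ω, rejProb κ i (fun j => (ω j).2) * M.Lfdr (ω i).2 ∂M.jointN n) -
        M.Ginv u * ∫ ω, rejProb κ i (fun j => (ω j).2) ∂M.jointN n := by
    intro i
    have hq := M.npTest_measurable u
    have e1 : M.lowMass u = ∫ ω, M.Lfdr (ω i).2 * M.npTest u (M.Lfdr (ω i).2) ∂M.jointN n :=
      (M.integral_jointN_comp_Lfdr i (measurable_id.mul hq)).symm
    have e2 : u = ∫ ω, M.npTest u (M.Lfdr (ω i).2) ∂M.jointN n :=
      (M.integral_npTest hu).symm.trans (M.integral_jointN_comp_Lfdr i hq).symm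
    have hqm := hq.comp (M.measurable_Lfdr_observation i)
    have i1 : Integrable (fun ω : Fin n → Bool × 𝒳 =>
        M.Lfdr (ω i).2 * M.npTest u (M.Lfdr (ω i).2)) (M.jointN n) :=
      M.integrable_jointN_of_abs_le_one ((M.measurable_Lfdr_observation i).mul hqm)
        fun _ => abs_mul_le_one ⟨M.Lfdr_nonneg _, M.Lfdr_le_one _⟩ (M.npTest_mem_Icc hu _)
    have i2 : Integrable (fun ω : Fin n → Bool × 𝒳 => M.npTest u (M.Lfdr (ω i).2))
        (M.jointN n) :=
      M.integrable_jointN_of_abs_le_one hqm fun ω => by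
        rw [abs_of_nonneg (M.npTest_mem_Icc hu _).1]
        exact (M.npTest_mem_Icc hu _).2
    have i3 := M.integrable_rejProb hκ i
    have i4 := M.integrable_rejProb_mul_Lfdr hκ i
    have e3 : M.Ginv u * u = ∫ ω, M.Ginv u * M.npTest u (M.Lfdr (ω i).2) ∂M.jointN n := by
      rw [integral_const_mul, ← e2]
    rw [e1, e3, ← integral_sub i1 (i2.const_mul _), ← integral_const_mul,
      ← integral_sub i4 (i3.const_mul _)]
    refine integral_mono (i1.sub (i2.const_mul _)) (i4.sub (i3.const_mul _)) fun ω => ?_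
    have := M.npTest_mul_sub_le (u := u) (w := M.Lfdr (ω i).2)
      (hκ.rejProb_mem_Icc i fun j => (ω j).2)
    dsimp only
    linarith
  have hs := Finset.sum_le_sum fun i (_ : i ∈ Finset.univ) => h i
  rwa [Finset.sum_const, Finset.card_fin, nsmul_eq_mul, Finset.sum_sub_distrib,
    ← Finset.mul_sum] at hs

lemma b_ustar_le_mFNR (hn : 0 < n) (hκ : IsRule κ) {α : ℝ} (hα : 0 ≤ α)
    (h : M.mFDR n κ ≤ α) : M.b (M.ustar α) ≤ M.mFNR n κ := by
  have hn' : (0 : ℝ) < n := Nat.cast_pos.2 hn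
  have hR := M.rejMass_mem_Icc hκ
  have hVU : M.nullMass n κ ≤ α * M.rejMass n κ := by
    rcases hR.1.eq_or_lt with h0 | h0
    · rw [← h0, mul_zero, h0]
      exact M.nullMass_le_rejMass hκ
    · rwa [M.mFDR_eq hκ, div_le_iff₀ h0] at h
  have hnum : (n - n * (∫ w, w ∂M.νW) - M.rejMass n κ + M.nullMass n κ) / n =
      1 - (∫ w, w ∂M.νW) - M.rejMass n κ / n + M.nullMass n κ / n := by
    field_simp
  have hden : (n - M.rejMass n κ) / n = 1 - M.rejMass n κ / n := by
    field_simp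
  rw [M.mFNR_eq hκ, ← div_div_div_cancel_right₀ hn'.ne', hnum, hden]
  refine M.b_ustar_le hα ⟨div_nonneg hR.1 hn'.le, div_le_one_of_le₀ hR.2 hn'.le⟩ ?_ ?_ ?_
  · intro u hu
    rw [← mul_div_assoc, ← sub_div, le_div_iff₀ hn', mul_comm]
    exact M.lowMass_sub_le_nullMass hκ hu
  · rw [← mul_div_assoc]
    exact div_le_div_of_nonneg_right hVU hn'.le
  · rw [← hnum]
    exact div_nonneg (M.acceptMass_nonneg hκ) hn'.le

end Masses

lemma qNP_eq (α : ℝ) (x : 𝒳) : M.qNP α x = M.npTest (M.ustar α) (M.Lfdr x) := rfl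

lemma qNP_measurable (α : ℝ) : Measurable (M.qNP α) :=
  (M.npTest_measurable _).comp M.Lfdr_measurable

end Model

lemma isProbabilityMeasure_bern {p : ℝ} (hp : p ∈ Set.Icc (0 : ℝ) 1) :
    IsProbabilityMeasure (bern p) := by
  refine ⟨?_⟩
  simp [bern, ← ENNReal.ofReal_add hp.1 (sub_nonneg.2 hp.2)]

lemma bern_real_true {p : ℝ} (hp : 0 ≤ p) : (bern p).real {true} = p := by
  simp [bern, Measure.real, hp]

lemma measurable_bern : Measurable bern := by
  refine Measure.measurable_of_measurable_coe _ fun s _ => ?_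
  simp only [bern, Measure.add_apply, Measure.smul_apply, smul_eq_mul]
  fun_prop

namespace Model

variable {𝒳 : Type*} [MeasurableSpace 𝒳] (M : Model 𝒳)

lemma isProbabilityMeasure_bern_qNP {α : ℝ} (hα : 0 ≤ α) (x : 𝒳) :
    IsProbabilityMeasure (bern (M.qNP α x)) :=
  isProbabilityMeasure_bern (M.npTest_mem_Icc (M.ustar_mem_Icc hα) _)

lemma isRule_NP {α : ℝ} (hα : 0 ≤ α) (n : ℕ) : IsRule (M.NP α n) := by
  have hb := M.isProbabilityMeasure_bern_qNP hα
  constructor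
  · refine Measure.measurable_of_measurable_coe _ fun s _ => ?_
    have e : ∀ x : Fin n → 𝒳, M.NP α n x s =
        ∑ d ∈ s.toFinite.toFinset, ∏ i, bern (M.qNP α (x i)) {d i} := by
      intro x
      have h1 : ∀ d : Fin n → Bool, M.NP α n x {d} = ∏ i, bern (M.qNP α (x i)) {d i} :=
        fun d => Measure.pi_singleton _ d
      simp_rw [← h1]
      rw [sum_measure_singleton, Set.Finite.coe_toFinset]
    simp_rw [e]
    refine Finset.measurable_sum _ fun d _ => Finset.measurable_prod _ fun i _ => ?_
    exact (Measure.measurable_coe (measurableSet_singleton _)).comp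
      (measurable_bern.comp ((M.qNP_measurable α).comp (measurable_pi_apply i)))
  · intro x
    unfold NP
    infer_instance

lemma rejProb_NP {α : ℝ} (hα : 0 ≤ α) {n : ℕ} (i : Fin n) (x : Fin n → 𝒳) :
    rejProb (M.NP α n) i x = M.npTest (M.ustar α) (M.Lfdr (x i)) := by
  have hb := M.isProbabilityMeasure_bern_qNP hα
  have h := (measurePreserving_eval (fun j => bern (M.qNP α (x j))) i).measureReal_preimage
    (measurableSet_singleton true).nullMeasurableSet
  rw [qNP_eq, bern_real_true (M.npTest_mem_Icc (M.ustar_mem_Icc hα) _).1] at h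
  exact h

lemma rejMass_NP {α : ℝ} (hα : 0 ≤ α) (n : ℕ) :
    M.rejMass n (M.NP α n) = n * M.ustar α := by
  simp only [rejMass, M.rejProb_NP hα,
    M.integral_jointN_comp_Lfdr _ (M.npTest_measurable (M.ustar α)),
    M.integral_npTest (M.ustar_mem_Icc hα)]
  simp

lemma nullMass_NP {α : ℝ} (hα : 0 ≤ α) (n : ℕ) :
    M.nullMass n (M.NP α n) = n * M.lowMass (M.ustar α) := by
  have h : ∀ i : Fin n, ∫ ω, M.npTest (M.ustar α) (M.Lfdr (ω i).2) * M.Lfdr (ω i).2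
      ∂M.jointN n = M.lowMass (M.ustar α) := by
    intro i
    simp_rw [mul_comm (M.npTest _ _)]
    exact M.integral_jointN_comp_Lfdr i (measurable_id.mul (M.npTest_measurable _))
  simp only [nullMass, M.rejProb_NP hα, h]
  simp

lemma mFDR_NP {α : ℝ} (hα : 0 ≤ α) {n : ℕ} (hn : 0 < n) :
    M.mFDR n (M.NP α n) = M.a (M.ustar α) := by
  rw [M.mFDR_eq (M.isRule_NP hα n), M.rejMass_NP hα, M.nullMass_NP hα, a_eq,
    mul_div_mul_left _ _ (Nat.cast_ne_zero.2 hn.ne')]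

lemma mFNR_NP {α : ℝ} (hα : 0 ≤ α) {n : ℕ} (hn : 0 < n) :
    M.mFNR n (M.NP α n) = M.b (M.ustar α) := by
  rw [M.mFNR_eq (M.isRule_NP hα n), M.rejMass_NP hα, M.nullMass_NP hα,
    M.b_eq (M.ustar_mem_Icc hα),
    ← mul_div_mul_left _ (1 - M.ustar α) (Nat.cast_ne_zero.2 hn.ne' : (n : ℝ) ≠ 0)]
  congr 1 <;> ring

lemma mFNRstarN_eq {α : ℝ} (hα : 0 ≤ α) {n : ℕ} (hn : 0 < n) :
    M.mFNRstarN n α = M.b (M.ustar α) := by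
  refine IsLeast.csInf_eq ⟨⟨M.NP α n, M.isRule_NP hα n, ?_, (M.mFNR_NP hα hn).symm⟩, ?_⟩
  · rw [M.mFDR_NP hα hn]
    exact M.a_ustar_le hα
  · rintro _ ⟨κ, hκ, h, rfl⟩
    exact M.b_ustar_le_mFNR hn hκ hα h

end Model

/-- **Optimal mFDR control** (Theorem 3). For each `α ∈ [0,1]`, `mFNR*(α) = b*(α)`, and the
Neyman–Pearson rule `δ^n_NP(α)` is an optimal solution of the mFDR-constrained problem:
it is feasible (`mFDR ≤ α`) and attains the optimal value `mFNR(δ^n_NP(α)) = mFNR*(α)`. -/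
theorem mFNRstar_eq_bstar_and_NP_optimal {𝒳 : Type*} [MeasurableSpace 𝒳] (M : Model 𝒳) :
    ∀ α ∈ Set.Icc (0 : ℝ) 1, ∀ n : ℕ, 0 < n →
      M.mFNRstarN n α = M.bstar α ∧
      IsRule (M.NP α n) ∧
      M.mFDR n (M.NP α n) ≤ α ∧
      M.mFNR n (M.NP α n) = M.mFNRstarN n α := by
  intro α hα n hn
  refine ⟨?_, M.isRule_NP hα.1 n, ?_, ?_⟩
  · rw [M.mFNRstarN_eq hα.1 hn, M.bstar_eq hα.1]
  · rw [M.mFDR_NP hα.1 hn]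
    exact M.a_ustar_le hα.1
  · rw [M.mFNR_NP hα.1 hn, M.mFNRstarN_eq hα.1 hn]

end TwoGroup
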